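/- Let L be an even lattice, h ∈ L a primitive vector with h² ≠ 0, and g an isometry of h^⊥. Then g extends to an isometry of L fixing h if and only if the induced action of g on the discriminant group A_{h^⊥} restricts to the identity on the subgroup p(H), where H = L/(Zh ⊕ h^⊥) and p : H ↪ A_{h^⊥} is the natural injection. -/

import Mathlib

/-- The projection `x ↦ x - (B x h / B h h) • h` along `h`. -/
def projAlong {V : Type*} [AddCommGroup V] [Module ℚ V] (B : LinearMap.BilinForm ℚ V) (h : V) :
    V →ₗ[ℚ] V :=
  LinearMap.id - ((B h h)⁻¹ • B.flip h).smulRight h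

lemma projAlong_apply {V : Type*} [AddCommGroup V] [Module ℚ V] (B : LinearMap.BilinForm ℚ V)
    (h x : V) : projAlong B h x = x - (B x h / B h h) • h := by
  simp [projAlong, div_eq_inv_mul]

lemma projAlong_orthogonal {V : Type*} [AddCommGroup V] [Module ℚ V]
    (B : LinearMap.BilinForm ℚ V) {h : V} (hh2 : B h h ≠ 0) (x : V) :
    B (projAlong B h x) h = 0 := by
  simp [projAlong_apply, hh2]

lemma projAlong_of_orthogonal {V : Type*} [AddCommGroup V] [Module ℚ V]
    (B : LinearMap.BilinForm ℚ V) {h x : V} (hx : B x h = 0) : projAlong B h x = x := by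
  simp [projAlong_apply, hx]

/-- A linear map preserving the lattice `h^⊥` preserves its rational span. -/
lemma orthogonal_map_of_lattice_map {V : Type*} [AddCommGroup V] [Module ℚ V]
    (B : LinearMap.BilinForm ℚ V) (L : Submodule ℤ V)
    (hspan : Submodule.span ℚ (L : Set V) = ⊤)
    (hint : ∀ x ∈ L, ∀ y ∈ L, ∃ n : ℤ, B x y = n)
    {h : V} (hh : h ∈ L) (hh2 : B h h ≠ 0) (g : V →ₗ[ℚ] V)
    (hg : ∀ x ∈ L, B x h = 0 → B (g x) h = 0) {x : V} (hx : B x h = 0) : B (g x) h = 0 := by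
  have hzero : B.flip h ∘ₗ g ∘ₗ projAlong B h = 0 := by
    refine LinearMap.ext_on hspan fun y hy => ?_
    obtain ⟨a, ha⟩ := hint h hh h hh
    obtain ⟨b, hb⟩ := hint y hy h hh
    have hscale : B h h • projAlong B h y = a • y - b • h := by
      rw [projAlong_apply, smul_sub, smul_smul, mul_div_cancel₀ _ hh2, ha, hb,
        Int.cast_smul_eq_zsmul, Int.cast_smul_eq_zsmul]
    have hmem : B h h • projAlong B h y ∈ L :=
      hscale ▸ L.sub_mem (L.smul_mem a hy) (L.smul_mem b hh)
    have hperp := hg _ hmem (by simp [projAlong_orthogonal B hh2])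
    simpa [hh2] using hperp
  simpa [projAlong_of_orthogonal B hx] using LinearMap.congr_fun hzero x


/-!
STATEMENT 3. Let `L` be an even lattice (modeled inside a `ℚ`-vector space `V` with
symmetric nondegenerate bilinear form `B`, integral and even on `L`), `h ∈ L` a primitive
vector with `h² ≠ 0`, and `g` an isometry of `h^⊥` (given as a `ℚ`-linear map on `V`
preserving `B` on the subspace `Vh = (ℚh)^⊥` and mapping the lattice
`Lperp = h^⊥ = L ∩ Vh` onto itself).  Then `g` extends to an isometry of `L` fixing `h`
iff the induced action of `g` on the discriminant group `A_{h^⊥}` is the identity on the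
subgroup `p(H)`, i.e. iff for every `ℓ ∈ L`, with `v = ℓ - (B ℓ h / B h h) • h ∈ Vh` its
`h^⊥`-component (so `p([ℓ]) = [v] ∈ A_{h^⊥}`), one has `g v - v ∈ Lperp`.
-/
theorem stmt_3 {V : Type*} [AddCommGroup V] [Module ℚ V] [FiniteDimensional ℚ V]
    (B : LinearMap.BilinForm ℚ V) (hsymm : ∀ x y, B x y = B y x)
    (hnd : B.Nondegenerate)
    (L : Submodule ℤ V) [Module.Finite ℤ L] [Module.Free ℤ L]
    (hspan : Submodule.span ℚ (L : Set V) = ⊤)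
    (hint : ∀ x ∈ L, ∀ y ∈ L, ∃ n : ℤ, B x y = n)
    (heven : ∀ x ∈ L, ∃ n : ℤ, B x x = 2 * n)
    (h : V) (hh : h ∈ L)
    (hhprim : ∀ (n : ℤ) (v : V), v ∈ L → h = n • v → IsUnit n)
    (hh2 : B h h ≠ 0)
    (Lperp : Submodule ℤ V)
    (hLperp : Lperp = L ⊓ (LinearMap.ker (B.flip h)).restrictScalars ℤ)
    (g : V →ₗ[ℚ] V)
    (hgiso : ∀ x y : V, B x h = 0 → B y h = 0 → B (g x) (g y) = B x y)
    (hgL : Submodule.map (g.restrictScalars ℤ) Lperp = Lperp) :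
    (∃ G : V →ₗ[ℚ] V, G h = h ∧ (∀ x : V, B x h = 0 → G x = g x) ∧
        (∀ x y : V, B (G x) (G y) = B x y) ∧ Submodule.map (G.restrictScalars ℤ) L = L)
      ↔ ∀ ℓ ∈ L, g (ℓ - (B ℓ h / B h h) • h) - (ℓ - (B ℓ h / B h h) • h) ∈ Lperp := by
  subst hLperp
  have mem_perp (x : V) : x ∈ L ⊓ (LinearMap.ker (B.flip h)).restrictScalars ℤ ↔
      x ∈ L ∧ B x h = 0 := by simp
  simp only [← projAlong_apply]
  constructor
  · rintro ⟨G, hGh, hGg, hGB, hGL⟩ ℓ hℓ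
    have hdiff : g (projAlong B h ℓ) - projAlong B h ℓ = G ℓ - ℓ := by
      rw [← hGg _ (projAlong_orthogonal B hh2 ℓ), projAlong_apply, map_sub, map_smul, hGh]
      abel
    have hGℓ : G ℓ ∈ L := hGL.le (Submodule.mem_map_of_mem hℓ)
    have hpair : B (G ℓ) h = B ℓ h := by simpa only [hGh] using hGB ℓ h
    rw [hdiff, mem_perp]
    exact ⟨L.sub_mem hGℓ hℓ, by simp [hpair]⟩
  · intro H
    have hgperp (x : V) (hx : B x h = 0) : B (g x) h = 0 :=
      orthogonal_map_of_lattice_map B L hspan hint hh hh2 g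
        (fun y hy hyh => ((mem_perp _).1
          (hgL.le (Submodule.mem_map_of_mem ((mem_perp y).2 ⟨hy, hyh⟩)))).2) hx
    let G : V →ₗ[ℚ] V := LinearMap.id + (g - LinearMap.id) ∘ₗ projAlong B h
    have hG (x : V) : G x = x + (g (projAlong B h x) - projAlong B h x) := by simp [G]
    have hGperp (x : V) (hx : B x h = 0) : G x = g x := by
      rw [hG, projAlong_of_orthogonal B hx]
      abel
    refine ⟨G, ?_, hGperp, fun x y => ?_, le_antisymm ?_ fun ℓ hℓ => ?_⟩
    · simp [hG, projAlong_apply, hh2]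
    · have hdecomp (z : V) : z = projAlong B h z + (B z h / B h h) • h := by
        simp [projAlong_apply]
      have hGdecomp (z : V) : G z = g (projAlong B h z) + (B z h / B h h) • h := by
        rw [hG, projAlong_apply]
        abel
      have hx := projAlong_orthogonal B hh2 x
      have hy := projAlong_orthogonal B hh2 y
      conv_rhs => rw [hdecomp x, hdecomp y]
      rw [hGdecomp, hGdecomp]
      simp only [map_add, map_smul, LinearMap.add_apply, LinearMap.smul_apply,
        hgiso _ _ hx hy, hgperp _ hx, hx, hsymm h, hgperp _ hy, hy]
    · rintro _ ⟨ℓ, hℓ, rfl⟩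
      change G ℓ ∈ L
      rw [hG]
      exact L.add_mem hℓ ((mem_perp _).1 (H ℓ hℓ)).1
    · obtain ⟨m, hm, hgm⟩ := hgL.ge (H ℓ hℓ)
      have hgm : g m = g (projAlong B h ℓ) - projAlong B h ℓ := hgm
      obtain ⟨hmL, hmh⟩ := (mem_perp m).1 hm
      refine ⟨ℓ - m, L.sub_mem hℓ hmL, ?_⟩
      change G (ℓ - m) = ℓ
      rw [map_sub, hGperp m hmh, hG ℓ, hgm, add_sub_cancel_right]
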